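/- arXiv:0811.3208 — 3 statements merged into one kernel-verified Lean document; each statement's English description precedes it below -/
import Mathlib

section
/- Let f(x) = xQx^t + Lx^t be a quadratic Boolean function on Z_2^n, where Q is an upper triangular n×n matrix over Z_2 with zero diagonal and L ∈ Z_2^n, and suppose the associated symplectic matrix B = Q + Q^t has rank(B) = n. Then f is a bent function. -/
open Matrix

/-- Inner product modulo 2 of two vectors in `Z_2^n`. -/
def dotp {n : ℕ} (u v : Fin n → ZMod 2) : ZMod 2 := ∑ i, u i * v i

/-- Fourier (Walsh) coefficient of a Boolean function `f : Z_2^n → Z_2` at frequency `w`: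
`f̂(w) = 2^{-n} Σ_x (-1)^{w·x + f(x)}`. -/
noncomputable def walshCoeff {n : ℕ} (f : (Fin n → ZMod 2) → ZMod 2)
    (w : Fin n → ZMod 2) : ℝ :=
  ((2 : ℝ) ^ n)⁻¹ * ∑ x : Fin n → ZMod 2, (-1 : ℝ) ^ ((dotp w x + f x).val)

/-- A Boolean function is bent if its Fourier spectrum is flat:
`|f̂(w)| = 2^{-n/2}` for all `w`. -/
def IsBent {n : ℕ} (f : (Fin n → ZMod 2) → ZMod 2) : Prop :=
  ∀ w, |walshCoeff f w| = (2 : ℝ) ^ (-(n : ℝ) / 2)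

lemma neg_one_pow_val_add (a b : ZMod 2) :
    (-1 : ℝ) ^ (a + b).val = (-1) ^ a.val * (-1) ^ b.val := by
  rw [ZMod.val_add, ← pow_add, neg_one_pow_eq_pow_mod_two (n := a.val + b.val)]

lemma dotp_eq_dotProduct {n : ℕ} (u v : Fin n → ZMod 2) : dotp u v = u ⬝ᵥ v := rfl

lemma sum_neg_one_pow_dotProduct {n : ℕ} (v : Fin n → ZMod 2) :
    ∑ x : Fin n → ZMod 2, (-1 : ℝ) ^ (x ⬝ᵥ v).val = if v = 0 then 2 ^ n else 0 := by
  split_ifs with hv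
  · simp [hv]
  · obtain ⟨i, hi⟩ := Function.ne_iff.mp hv
    have hi1 : v i = 1 := Fin.eq_one_of_ne_zero _ hi
    have h := Equiv.sum_comp (Equiv.addRight (Pi.single i (1 : ZMod 2)))
      (fun x : Fin n → ZMod 2 => (-1 : ℝ) ^ (x ⬝ᵥ v).val)
    simp only [Equiv.coe_addRight, add_dotProduct, single_dotProduct, hi1,
      neg_one_pow_val_add, ← Finset.sum_mul] at h
    norm_num [ZMod.val_one] at h
    linarith

/-- If `g` polarizes to a nondegenerate bilinear form, its exponential sum squares to `2 ^ n`. -/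
lemma sq_sum_neg_one_pow_of_polar {n : ℕ} (g : (Fin n → ZMod 2) → ZMod 2)
    (B : Matrix (Fin n) (Fin n) (ZMod 2)) (hB : Function.Injective B.mulVec)
    (hg : ∀ x y, g (x + y) = g x + g y + x ⬝ᵥ B *ᵥ y) :
    (∑ x, (-1 : ℝ) ^ (g x).val) ^ 2 = 2 ^ n := by
  have hg0 : g 0 = 0 := by simpa using hg 0 0
  have hB0 (y : Fin n → ZMod 2) : B *ᵥ y = 0 ↔ y = 0 :=
    ⟨fun h => hB (by simpa using h), fun h => by simp [h]⟩
  calc (∑ x, (-1 : ℝ) ^ (g x).val) ^ 2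
      = ∑ x, ∑ y, (-1 : ℝ) ^ (g x).val * (-1) ^ (g (x + y)).val := by
        rw [sq, Finset.sum_mul_sum]
        refine Finset.sum_congr rfl fun x _ => ?_
        exact (Equiv.sum_comp (Equiv.addLeft x)
          fun y => (-1 : ℝ) ^ (g x).val * (-1) ^ (g y).val).symm
    _ = ∑ x, ∑ y, (-1 : ℝ) ^ (g y).val * (-1) ^ (x ⬝ᵥ B *ᵥ y).val := by
        refine Finset.sum_congr rfl fun x _ => Finset.sum_congr rfl fun y _ => ?_
        rw [← neg_one_pow_val_add, ← neg_one_pow_val_add, hg, add_assoc, ← add_assoc (g x),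
          CharTwo.add_self_eq_zero, zero_add]
    _ = 2 ^ n := by
        rw [Finset.sum_comm]
        simp only [← Finset.mul_sum, sum_neg_one_pow_dotProduct, hB0]
        simp [hg0]

/-- a quadratic Boolean function `f(x) = xQxᵗ + Lxᵗ` whose associated
symplectic matrix `B = Q + Qᵗ` has full rank `n` is a bent function. -/
theorem quadratic_full_rank_bent {n : ℕ}
    (Q : Matrix (Fin n) (Fin n) (ZMod 2))
    (hQ : ∀ i j : Fin n, j ≤ i → Q i j = 0)  -- upper triangular with zero diagonal
    (L : Fin n → ZMod 2)
    (f : (Fin n → ZMod 2) → ZMod 2)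
    (hf : ∀ x, f x = dotp x (Q.mulVec x) + dotp L x)
    (hrank : (Q + Qᵀ).rank = n) :
    IsBent f := by
  intro w
  have hinj : Function.Injective (Q + Qᵀ).mulVec := by
    rw [mulVec_injective_iff, linearIndependent_iff_card_eq_finrank_span,
      Set.finrank, ← rank_eq_finrank_span_cols, hrank, Fintype.card_fin]
  have hsq := sq_sum_neg_one_pow_of_polar (fun x => dotp w x + f x) (Q + Qᵀ) hinj (by
    intro x y
    have hxy : x ⬝ᵥ Qᵀ *ᵥ y = y ⬝ᵥ Q *ᵥ x := by
      rw [mulVec_transpose, dotProduct_comm, ← dotProduct_mulVec]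
    simp only [hf, dotp_eq_dotProduct, mulVec_add, add_mulVec, dotProduct_add, add_dotProduct, hxy]
    ring)
  rw [← sq_eq_sq₀ (abs_nonneg _) (by positivity), sq_abs, walshCoeff, mul_pow, hsq,
    ← Real.rpow_natCast (2 ^ (-(n : ℝ) / 2)), ← Real.rpow_mul zero_le_two]
  rw [show -(n : ℝ) / 2 * (2 : ℕ) = -n by push_cast; ring, Real.rpow_neg zero_le_two,
    Real.rpow_natCast]
  field_simp
end

section
/- (Dickson's theorem, matrix form.) Let B be an n×n symmetric matrix over Z_2 with zero diagonal (a symplectic matrix). Then there exists an invertible matrix R ∈ GL(n, Z_2) and an integer h with 0 ≤ 2h ≤ n such that R B R^t = D, where D is the block-diagonal matrix consisting of h copies of the 2×2 matrix [[0,1],[1,0]] followed by an (n−2h)×(n−2h) zero block. In particular, the rank of B is even. -/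
open Matrix

/-- The block-diagonal matrix with `h` blocks `[[0,1],[1,0]]` followed by a zero block. -/
def hyperbolicBlocks (n h : ℕ) : Matrix (Fin n) (Fin n) (ZMod 2) :=
  Matrix.of (fun i j : Fin n =>
    if i.val < 2 * h ∧ j.val < 2 * h ∧ i.val / 2 = j.val / 2 ∧ i ≠ j
    then (1 : ZMod 2) else 0)

/-- Congruence of square matrices by an invertible matrix. -/
def IsCongruent {n : ℕ} (B C : Matrix (Fin n) (Fin n) (ZMod 2)) : Prop :=
  ∃ R : Matrix (Fin n) (Fin n) (ZMod 2), IsUnit R ∧ R * B * Rᵀ = C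

theorem IsCongruent.refl {n : ℕ} (B : Matrix (Fin n) (Fin n) (ZMod 2)) : IsCongruent B B :=
  ⟨1, isUnit_one, by simp⟩

theorem IsCongruent.trans {n : ℕ} {B C D : Matrix (Fin n) (Fin n) (ZMod 2)}
    (hBC : IsCongruent B C) (hCD : IsCongruent C D) : IsCongruent B D := by
  obtain ⟨R, hR, rfl⟩ := hBC
  obtain ⟨S, hS, rfl⟩ := hCD
  exact ⟨S * R, hS.mul hR, by simp only [transpose_mul, Matrix.mul_assoc]⟩

theorem isCongruent_submatrix {n : ℕ} (B : Matrix (Fin n) (Fin n) (ZMod 2))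
    (σ : Equiv.Perm (Fin n)) : IsCongruent B (B.submatrix σ σ) := by
  refine ⟨(1 : Matrix (Fin n) (Fin n) (ZMod 2)).submatrix σ id, ?_, ?_⟩
  · rw [Matrix.isUnit_iff_isUnit_det, Matrix.det_permute]
    simp only [det_one, mul_one]
    exact (Equiv.Perm.sign σ).isUnit.map (Int.castRingHom (ZMod 2))
  · ext i j
    simp [Matrix.mul_apply, Matrix.one_apply]

/-- Adding multiples of rows (and columns) `p` and `q` to the remaining ones. -/
theorem exists_isCongruent_add_rows {n : ℕ} (C : Matrix (Fin n) (Fin n) (ZMod 2))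
    (p q : Fin n) (a b : Fin n → ZMod 2) (hap : a p = 0) (haq : a q = 0)
    (hbp : b p = 0) (hbq : b q = 0) :
    IsCongruent C (Matrix.of fun i j =>
      (C i j + a i * C p j + b i * C q j) + a j * (C i p + a i * C p p + b i * C q p)
        + b j * (C i q + a i * C p q + b i * C q q)) := by
  set T : Matrix (Fin n) (Fin n) (ZMod 2) :=
    Matrix.of fun i => Pi.single i 1 + a i • Pi.single p 1 + b i • Pi.single q 1 with hT
  have hmul : ∀ (A : Matrix (Fin n) (Fin n) (ZMod 2)) i j,
      (T * A) i j = A i j + a i * A p j + b i * A q j := by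
    intro A i j
    simp [hT, Matrix.mul_apply, add_mul, Finset.sum_add_distrib, Pi.single_apply]
  refine ⟨T, ?_, ?_⟩
  · have hTT : T * T = 1 := by
      ext i j
      rw [hmul]
      simp only [hT, of_apply, Pi.add_apply, Pi.smul_apply, smul_eq_mul, hap, haq, hbp, hbq,
        zero_mul, add_zero, Pi.single_apply, Matrix.one_apply, eq_comm (a := j)]
      linear_combination CharTwo.add_self_eq_zero (a i * if p = j then 1 else 0)
        + CharTwo.add_self_eq_zero (b i * if q = j then 1 else 0)
    exact IsUnit.of_mul_eq_one T hTT
  · ext i j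
    have h : T * C * Tᵀ = (T * (T * C)ᵀ)ᵀ := by simp
    rw [h, transpose_apply, hmul]
    simp only [transpose_apply, hmul, of_apply]

theorem exists_perm_of_le {n m : ℕ} (hm : m + 1 < n) {p q : Fin n} (hpq : p ≠ q)
    (hp : m ≤ p.val) (hq : m ≤ q.val) :
    ∃ σ : Equiv.Perm (Fin n), (∀ i : Fin n, i.val < m → σ i = i) ∧
      σ ⟨m, by omega⟩ = p ∧ σ ⟨m + 1, hm⟩ = q := by
  set u : Fin n := ⟨m, by omega⟩ with hu
  set v : Fin n := ⟨m + 1, hm⟩ with hv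
  have huv : u ≠ v := by simp [hu, hv]
  have hq' : Equiv.swap u p q ≠ u := by
    rw [Ne, Equiv.swap_apply_eq_iff, Equiv.swap_apply_left]
    exact hpq.symm
  have hmq : m ≤ (Equiv.swap u p q).val := by
    rw [Equiv.swap_apply_def]
    split_ifs <;> simp_all
  refine ⟨Equiv.swap u p * Equiv.swap v (Equiv.swap u p q), fun i hi => ?_, ?_, ?_⟩
  · have hi' : ∀ x : Fin n, m ≤ x.val → i ≠ x := by
      rintro x hx rfl
      omega
    rw [Equiv.Perm.mul_apply,
      Equiv.swap_apply_of_ne_of_ne (hi' v (by simp [hv])) (hi' _ hmq),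
      Equiv.swap_apply_of_ne_of_ne (hi' u (by simp [hu])) (hi' _ hp)]
  · rw [Equiv.Perm.mul_apply, Equiv.swap_apply_of_ne_of_ne huv hq'.symm, Equiv.swap_apply_left]
  · rw [Equiv.Perm.mul_apply, Equiv.swap_apply_left, Equiv.swap_apply_self]

/-- Splitting off one more hyperbolic block. -/
theorem exists_isCongruent_succ {n h : ℕ} (C : Matrix (Fin n) (Fin n) (ZMod 2))
    (hsymm : ∀ i j, C i j = C j i) (hdiag : ∀ i, C i i = 0)
    (hC : ∀ i j : Fin n, i.val < 2 * h → C i j = hyperbolicBlocks n h i j)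
    {p q : Fin n} (hpq : C p q = 1) (hp : 2 * h ≤ p.val) (hq : 2 * h ≤ q.val) :
    2 * (h + 1) ≤ n ∧ ∃ C' : Matrix (Fin n) (Fin n) (ZMod 2), IsCongruent C C' ∧
      (∀ i j, C' i j = C' j i) ∧ (∀ i, C' i i = 0) ∧
      ∀ i j : Fin n, i.val < 2 * (h + 1) → C' i j = hyperbolicBlocks n (h + 1) i j := by
  have hne : p ≠ q := by
    rintro rfl
    simp [hdiag] at hpq
  have hn : 2 * h + 1 < n := by
    have := Fin.val_ne_of_ne hne
    omega
  refine ⟨by omega, ?_⟩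
  obtain ⟨σ, hσ, hσp, hσq⟩ := exists_perm_of_le hn hne hp hq
  set u : Fin n := ⟨2 * h, by omega⟩ with hu
  set v : Fin n := ⟨2 * h + 1, hn⟩ with hv
  set M := C.submatrix σ σ with hM
  have hMsymm : ∀ i j, M i j = M j i := fun i j => hsymm _ _
  have hMdiag : ∀ i, M i i = 0 := fun i => hdiag _
  have hMuv : M u v = 1 := by simp [hM, hσp, hσq, hpq]
  have hMvu : M v u = 1 := hMsymm v u ▸ hMuv
  have hσlt : ∀ j : Fin n, 2 * h ≤ j.val → 2 * h ≤ (σ j).val := by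
    intro j hj
    by_contra! hlt
    have := σ.injective (hσ _ hlt)
    rw [this] at hlt
    omega
  have hMC : ∀ i j : Fin n, i.val < 2 * h → M i j = hyperbolicBlocks n h i j := by
    intro i j hi
    rw [hM, submatrix_apply, hσ i hi, hC i _ hi]
    rcases lt_or_ge j.val (2 * h) with hj | hj
    · rw [hσ j hj]
    · have := hσlt j hj
      simp [hyperbolicBlocks, not_lt.2 hj, not_lt.2 this]
  have hMu : ∀ i : Fin n, i.val < 2 * h → M i u = 0 := fun i hi => by
    rw [hMC i u hi]; simp [hyperbolicBlocks, hu]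
  have hMv : ∀ i : Fin n, i.val < 2 * h → M i v = 0 := fun i hi => by
    rw [hMC i v hi]; simp [hyperbolicBlocks, hv]
  set a : Fin n → ZMod 2 := fun i => if i = u ∨ i = v then 0 else M i v with ha
  set b : Fin n → ZMod 2 := fun i => if i = u ∨ i = v then 0 else M i u with hb
  refine ⟨_, (isCongruent_submatrix C σ).trans (exists_isCongruent_add_rows M u v a b
    (by simp [ha]) (by simp [ha]) (by simp [hb]) (by simp [hb])), ?_, ?_, ?_⟩
  · intro i j
    simp only [of_apply, hMdiag, hMuv, hMvu, hMsymm j i, hMsymm u, hMsymm v]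
    ring
  · intro i
    simp only [of_apply, hMdiag, hMuv, hMvu, hMsymm u i, hMsymm v i]
    linear_combination CharTwo.add_self_eq_zero (a i * M i u)
      + CharTwo.add_self_eq_zero (b i * M i v)
      + CharTwo.add_self_eq_zero (a i * b i)
  · intro i j hi
    rcases lt_or_ge i.val (2 * h) with hi' | hi'
    · have hai : a i = 0 := by simp [ha, hMv i hi']
      have hbi : b i = 0 := by simp [hb, hMu i hi']
      simp only [of_apply, hai, hbi, hMu i hi', hMv i hi', hMC i j hi']
      simp only [hyperbolicBlocks, of_apply]
      simp only [zero_mul, mul_zero, add_zero]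
      congr 1
      simp only [eq_iff_iff]
      grind
    · have hval : i = u ∨ i = v := by
        simp only [hu, hv, Fin.ext_iff]
        omega
      have hai : a i = 0 := by simp [ha, hval]
      have hbi : b i = 0 := by simp [hb, hval]
      simp only [of_apply, hai, hbi, zero_mul, add_zero]
      by_cases hj : j = u ∨ j = v
      · have haj : a j = 0 := by simp [ha, hj]
        have hbj : b j = 0 := by simp [hb, hj]
        simp only [haj, hbj, zero_mul, add_zero]
        rcases hval with rfl | rfl <;> rcases hj with rfl | rfl <;>
          simp only [hMdiag, hMuv, hMvu] <;> simp [hyperbolicBlocks, hu, hv] <;> omega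
      · have haj : a j = M j v := by simp [ha, hj]
        have hbj : b j = M j u := by simp [hb, hj]
        have hz : hyperbolicBlocks n (h + 1) i j = 0 := by
          simp only [hu, hv, Fin.ext_iff] at hj hval
          simp only [hyperbolicBlocks, of_apply]
          rw [if_neg]
          omega
        rw [haj, hbj, hz]
        rcases hval with rfl | rfl
        · rw [hMdiag, hMuv, hMsymm j u]
          linear_combination CharTwo.add_self_eq_zero (M u j)
        · rw [hMdiag, hMvu, hMsymm j v]
          linear_combination CharTwo.add_self_eq_zero (M v j)

theorem exists_isCongruent_hyperbolicBlocks {n : ℕ} (h : ℕ) (hn : 2 * h ≤ n)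
    (C : Matrix (Fin n) (Fin n) (ZMod 2))
    (hsymm : ∀ i j, C i j = C j i) (hdiag : ∀ i, C i i = 0)
    (hC : ∀ i j : Fin n, i.val < 2 * h → C i j = hyperbolicBlocks n h i j) :
    ∃ k, 2 * k ≤ n ∧ IsCongruent C (hyperbolicBlocks n k) := by
  by_cases hzero : ∀ p q : Fin n, 2 * h ≤ p.val → 2 * h ≤ q.val → C p q = 0
  · refine ⟨h, hn, ?_⟩
    have : C = hyperbolicBlocks n h := by
      ext i j
      rcases lt_or_ge i.val (2 * h) with hi | hi
      · exact hC i j hi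
      · rcases lt_or_ge j.val (2 * h) with hj | hj
        · rw [hsymm, hC j i hj]
          simp [hyperbolicBlocks, not_lt.2 hi]
        · rw [hzero i j hi hj]
          simp [hyperbolicBlocks, not_lt.2 hi]
    exact this ▸ IsCongruent.refl C
  · push Not at hzero
    obtain ⟨p, q, hp, hq, hpq⟩ := hzero
    obtain ⟨hn', C', hCC', hsymm', hdiag', hC'⟩ := exists_isCongruent_succ C hsymm hdiag hC
      (Fin.eq_one_of_ne_zero _ hpq) hp hq
    obtain ⟨k, hk, hCk⟩ := exists_isCongruent_hyperbolicBlocks (h + 1) hn' C' hsymm' hdiag' hC'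
    exact ⟨k, hk, hCC'.trans hCk⟩
termination_by n - 2 * h

theorem hyperbolicBlocks_mul {n h : ℕ} (hn : 2 * h ≤ n) :
    hyperbolicBlocks n h * hyperbolicBlocks n h =
      diagonal fun i : Fin n => if i.val < 2 * h then 1 else 0 := by
  ext i j
  rw [Matrix.mul_apply, diagonal_apply]
  by_cases hi : i.val < 2 * h
  · obtain ⟨k, hk, hki, hne⟩ : ∃ k : Fin n, k.val < 2 * h ∧ i.val / 2 = k.val / 2 ∧ i ≠ k := by
      rcases Nat.even_or_odd' i.val with ⟨c, hc | hc⟩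
      · refine ⟨⟨2 * c + 1, by omega⟩, ?_, ?_, ?_⟩ <;> simp [Fin.ext_iff] <;> omega
      · refine ⟨⟨2 * c, by omega⟩, ?_, ?_, ?_⟩ <;> simp [Fin.ext_iff] <;> omega
    rw [Finset.sum_eq_single k]
    · simp only [hyperbolicBlocks, of_apply]
      simp only [Fin.ext_iff, Ne] at hne ⊢
      split_ifs <;> first | (exfalso; omega) | simp
    · intro l _ hl
      simp only [hyperbolicBlocks, of_apply]
      rw [if_neg, zero_mul]
      simp only [Fin.ext_iff, Ne] at hne hl ⊢
      omega
    · simp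
  · simp [hyperbolicBlocks, hi]

theorem rank_hyperbolicBlocks {n h : ℕ} (hn : 2 * h ≤ n) :
    (hyperbolicBlocks n h).rank = 2 * h := by
  have hP : (diagonal fun i : Fin n => if i.val < 2 * h then (1 : ZMod 2) else 0).rank
      = 2 * h := by
    rw [rank_diagonal]
    simp [Fintype.card_subtype, Fin.card_filter_val_lt, hn]
  have hPD : (diagonal fun i : Fin n => if i.val < 2 * h then (1 : ZMod 2) else 0) *
      hyperbolicBlocks n h = hyperbolicBlocks n h := by
    ext i j
    rw [diagonal_mul]
    by_cases hi : i.val < 2 * h <;> simp [hyperbolicBlocks, hi]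
  apply le_antisymm
  · rw [← hPD]
    exact (rank_mul_le_left _ _).trans hP.le
  · rw [← hP, ← hyperbolicBlocks_mul hn]
    exact rank_mul_le_left _ _

/-- Dickson's theorem, matrix form: every symmetric matrix over `Z_2` with
zero diagonal is congruent to a block-diagonal matrix consisting of `h` copies of the
`2×2` matrix `[[0,1],[1,0]]` followed by a zero block; in particular its rank `2h` is even. -/
theorem dickson_matrix_form {n : ℕ}
    (B : Matrix (Fin n) (Fin n) (ZMod 2))
    (hsymm : Bᵀ = B) (hdiag : ∀ i, B i i = 0) :
    (∃ R : Matrix (Fin n) (Fin n) (ZMod 2), IsUnit R ∧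
      ∃ h : ℕ, 2 * h ≤ n ∧
        R * B * Rᵀ = Matrix.of (fun i j : Fin n =>
          if i.val < 2 * h ∧ j.val < 2 * h ∧ i.val / 2 = j.val / 2 ∧ i ≠ j
          then (1 : ZMod 2) else 0)) ∧
    Even B.rank := by
  obtain ⟨h, hn, R, hR, hRB⟩ := exists_isCongruent_hyperbolicBlocks 0 (Nat.zero_le n) B
    (fun i j => congrFun (congrFun hsymm.symm i) j) hdiag (fun i j hi => by omega)
  refine ⟨⟨R, hR, h, hn, hRB⟩, h, ?_⟩
  have hdet : IsUnit R.det := (isUnit_iff_isUnit_det R).1 hR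
  rw [← two_mul, ← rank_hyperbolicBlocks hn, ← hRB,
    rank_mul_eq_left_of_isUnit_det _ _ (by rwa [det_transpose]),
    rank_mul_eq_right_of_isUnit_det _ _ hdet]
end

section
/- (Dickson's theorem, quadratic-form part.) Let f(x) = xQx^t + Lx^t be a quadratic Boolean function on Z_2^n, where Q is upper triangular with zero diagonal and L ∈ Z_2^n, and let B = Q + Q^t have rank 2h. Then there is an invertible linear change of variables R ∈ GL(n, Z_2) and a linear function L' : Z_2^n → Z_2 such that for all x, f(xR) = x_1 x_2 + x_3 x_4 + ... + x_{2h-1} x_{2h} + L'(x), i.e., under the base change f becomes the inner product function ip_h on the first 2h variables plus a linear function. -/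
open Matrix

/-- An alternating matrix of rank at most `2h` is a sum of `h` elementary alternating matrices
`u vᵀ - v uᵀ`. -/
theorem Matrix.exists_eq_sum_vecMulVec_sub_of_alternating {K ι : Type*} [Field K] [Fintype ι]
    [DecidableEq ι] (h : ℕ) (M : Matrix ι ι K) (hskew : ∀ a b, M b a = -M a b)
    (hdiag : ∀ a, M a a = 0) (hrank : M.rank ≤ 2 * h) :
    ∃ u v : Fin h → ι → K, ∀ a b, M a b = ∑ i, (u i a * v i b - v i a * u i b) := by
  induction h generalizing M with
  | zero =>
    have h0 : M = 0 := by
      have hr : Module.finrank K (LinearMap.range M.mulVecLin) = 0 := by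
        simpa [Matrix.rank] using hrank
      rw [Submodule.finrank_eq_zero, LinearMap.range_eq_bot] at hr
      ext a b
      simpa using congrFun (LinearMap.congr_fun hr (Pi.single b 1)) a
    exact ⟨0, 0, by simp [h0]⟩
  | succ h ih =>
    by_cases h0 : M = 0
    · exact ⟨0, 0, by simp [h0]⟩
    obtain ⟨i, j, hc⟩ : ∃ i j, M i j ≠ 0 := by
      by_contra! hM
      exact h0 (Matrix.ext hM)
    set c := M i j with hcdef
    have hji : M j i = -c := hskew i j
    let N : Matrix ι ι K := Matrix.of fun a b => M a b + c⁻¹ * (M a i * M j b - M a j * M i b)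
    have hNi : ∀ b, N i b = 0 := fun b => by
      simp only [N, Matrix.of_apply, hdiag, ← hcdef]
      field_simp
      ring
    have hNj : ∀ b, N j b = 0 := fun b => by
      simp only [N, Matrix.of_apply, hdiag, hji]
      field_simp
      ring
    have hle : LinearMap.range N.mulVecLin ≤ LinearMap.range M.mulVecLin := by
      rintro _ ⟨x, rfl⟩
      refine ⟨x + c⁻¹ • ((M j ⬝ᵥ x) • Pi.single i 1 - (M i ⬝ᵥ x) • Pi.single j 1), ?_⟩
      ext a
      simp only [map_add, map_sub, map_smul, Matrix.mulVecLin_apply, Matrix.mulVec_single_one,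
        Pi.add_apply, Pi.smul_apply, Pi.sub_apply, smul_eq_mul, Matrix.col_apply]
      simp only [Matrix.mulVec, dotProduct, N, Matrix.of_apply, add_mul, mul_sub, sub_mul,
        Finset.sum_add_distrib, Finset.sum_sub_distrib, Finset.sum_mul, Finset.mul_sum]
      congr 2 <;> exact Finset.sum_congr rfl fun _ _ => by ring
    have hcol : ∀ k, M.col k ∈ LinearMap.range M.mulVecLin := fun k =>
      ⟨Pi.single k 1, by simp⟩
    have hlt₁ : LinearMap.range M.mulVecLin ⊓
        LinearMap.ker (LinearMap.proj (R := K) (φ := fun _ => K) j) <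
          LinearMap.range M.mulVecLin := by
      refine lt_of_le_of_ne inf_le_left fun he => ?_
      have := he.ge (hcol i)
      simp [hji, hc] at this
    have hlt₂ : LinearMap.range N.mulVecLin <
        LinearMap.range M.mulVecLin ⊓
          LinearMap.ker (LinearMap.proj (R := K) (φ := fun _ => K) j) := by
      refine lt_of_le_of_ne (le_inf hle ?_) fun he => ?_
      · rintro _ ⟨x, rfl⟩
        simp [Matrix.mulVec, dotProduct, hNj]
      · have hmem := he.ge ⟨hcol j, by simp [hdiag]⟩
        obtain ⟨x, hx⟩ := hmem
        have := congrFun hx i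
        simp [Matrix.mulVec, dotProduct, hNi] at this
        exact hc this.symm
    have hNrank : N.rank ≤ 2 * h := by
      have h₁ := Submodule.finrank_lt_finrank_of_lt hlt₁
      have h₂ := Submodule.finrank_lt_finrank_of_lt hlt₂
      unfold Matrix.rank at hrank ⊢
      omega
    obtain ⟨u, v, huv⟩ := ih N
      (fun a b => by
        simp only [N, Matrix.of_apply, hskew a b, hskew i b, hskew j b, hskew a j, hskew a i]
        ring)
      (fun a => by
        simp only [N, Matrix.of_apply, hdiag, hskew a j, hskew a i]
        ring) hNrank
    refine ⟨Fin.cons (c⁻¹ • M.col i) u, Fin.cons (M.col j) v, fun a b => ?_⟩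
    rw [Fin.sum_univ_succ]
    simp only [Fin.cons_zero, Fin.cons_succ, ← huv, N, Matrix.of_apply, Pi.smul_apply,
      smul_eq_mul, Matrix.col_apply, hskew b i, hskew b j]
    ring

/-- A finite linearly independent family in `κ → K` extends to a basis indexed by `κ`, along any
embedding of its index type into `κ`. -/
theorem LinearIndependent.exists_basis_extending {K ι κ : Type*} [Field K] [Finite ι]
    [Finite κ] {w : ι → κ → K} (hw : LinearIndependent K w) (g : ι ↪ κ) :
    ∃ b : Module.Basis κ K (κ → K), ∀ i, b (g i) = w i := by
  let b₀ := Module.Basis.extend hw.linearIndepOn_id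
  have hmem : ∀ i, w i ∈ hw.linearIndepOn_id.extend (Set.subset_univ (Set.range w)) := fun i =>
    Module.Basis.subset_extend hw.linearIndepOn_id ⟨i, rfl⟩
  let e := b₀.indexEquiv (Pi.basisFun K κ)
  obtain ⟨σ, hσ⟩ := Equiv.Perm.exists_extending_pair (fun i => e ⟨w i, hmem i⟩) g
    (fun i j hij => hw.injective (congrArg Subtype.val (e.injective hij))) g.injective
  refine ⟨b₀.reindex (e.trans σ), fun i => ?_⟩
  rw [Module.Basis.reindex_apply, ← hσ i]
  simp [b₀]

/-- Dickson's theorem, quadratic-form part: if `f(x) = xQxᵗ + Lxᵗ` is a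
quadratic Boolean function whose associated symplectic matrix `B = Q + Qᵗ` has rank `2h`,
then there is an invertible change of variables `R` and a linear function `x ↦ a·x` such
that `f(xR) = x₁x₂ + x₃x₄ + ⋯ + x_{2h-1}x_{2h} + a·x` for all `x`. -/
theorem dickson_quadratic_form {n : ℕ}
    (Q : Matrix (Fin n) (Fin n) (ZMod 2))
    (hQ : ∀ i j : Fin n, j ≤ i → Q i j = 0)  -- upper triangular with zero diagonal
    (L : Fin n → ZMod 2)
    (f : (Fin n → ZMod 2) → ZMod 2)
    (hf : ∀ x, f x = dotp x (Q.mulVec x) + dotp L x)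
    (h : ℕ) (hhn : 2 * h ≤ n)
    (hrank : (Q + Qᵀ).rank = 2 * h) :
    ∃ R : Matrix (Fin n) (Fin n) (ZMod 2), IsUnit R ∧
      ∃ a : Fin n → ZMod 2,
        ∀ x, f (Matrix.vecMul x R) =
          (∑ i : Fin h,
            x ⟨2 * i.val, by have := i.isLt; omega⟩ *
            x ⟨2 * i.val + 1, by have := i.isLt; omega⟩) + dotp a x := by
  have hdiag : ∀ a, (Q + Qᵀ) a a = 0 := fun a => by simp [hQ a a le_rfl]
  have hskew : ∀ a b, (Q + Qᵀ) b a = -(Q + Qᵀ) a b := fun a b => by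
    rw [CharTwo.neg_eq]; simp [add_comm]
  obtain ⟨u, v, huv⟩ := Matrix.exists_eq_sum_vecMulVec_sub_of_alternating h _ hskew hdiag hrank.le
  let w : Fin h × Fin 2 → Fin n → ZMod 2 := fun p => if p.2 = 0 then u p.1 else v p.1
  have hw : LinearIndependent (ZMod 2) w := by
    rw [linearIndependent_iff_card_le_finrank_span]
    have hle : LinearMap.range (Q + Qᵀ).mulVecLin ≤ Submodule.span (ZMod 2) (Set.range w) := by
      rintro _ ⟨x, rfl⟩
      have hx : (Q + Qᵀ).mulVecLin x = ∑ i, ((v i ⬝ᵥ x) • w (i, 0) - (u i ⬝ᵥ x) • w (i, 1)) := by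
        ext a
        simp only [Matrix.mulVecLin_apply, Matrix.mulVec, dotProduct, huv, w, Finset.sum_apply,
          Pi.sub_apply, Pi.smul_apply, smul_eq_mul, Finset.sum_mul]
        rw [Finset.sum_comm]
        refine Finset.sum_congr rfl fun i _ => ?_
        simp only [if_true, one_ne_zero, if_false, ← Finset.sum_sub_distrib]
        exact Finset.sum_congr rfl fun _ _ => by ring
      rw [hx]
      exact Submodule.sum_mem _ fun i _ => Submodule.sub_mem _
        (Submodule.smul_mem _ _ (Submodule.subset_span ⟨_, rfl⟩))
        (Submodule.smul_mem _ _ (Submodule.subset_span ⟨_, rfl⟩))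
    calc Fintype.card (Fin h × Fin 2) = (Q + Qᵀ).rank := by simp [hrank, mul_comm]
      _ ≤ _ := Submodule.finrank_mono hle
  let g : Fin h × Fin 2 ↪ Fin n :=
    ⟨fun p => ⟨2 * p.1 + p.2, by omega⟩, fun p q hpq => by
      simp only [Fin.mk.injEq] at hpq
      ext <;> omega⟩
  obtain ⟨b, hb⟩ := hw.exists_basis_extending g
  let P : Matrix (Fin n) (Fin n) (ZMod 2) := Matrix.of b
  have hP : IsUnit P := Matrix.linearIndependent_rows_iff_isUnit.mp b.linearIndependent
  have hPdet := (Matrix.isUnit_iff_isUnit_det P).mp hP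
  have hPx : ∀ x k, b k ⬝ᵥ (x ᵥ* (P⁻¹)ᵀ) = x k := fun x k => by
    have : P *ᵥ (x ᵥ* (P⁻¹)ᵀ) = x := by
      rw [Matrix.vecMul_transpose, Matrix.mulVec_mulVec, Matrix.mul_nonsing_inv _ hPdet,
        Matrix.one_mulVec]
    exact congrFun this k
  have hu : ∀ x (i : Fin h), u i ⬝ᵥ (x ᵥ* (P⁻¹)ᵀ) = x ⟨2 * i, by omega⟩ := fun x i => by
    rw [← hPx x, show b ⟨2 * i, _⟩ = u i from hb (i, 0)]
  have hv : ∀ x (i : Fin h), v i ⬝ᵥ (x ᵥ* (P⁻¹)ᵀ) = x ⟨2 * i + 1, by omega⟩ := fun x i => by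
    rw [← hPx x, show b ⟨2 * i + 1, _⟩ = v i from hb (i, 1)]
  have hpolar : ∀ x y, f (x + y) = f x + f y +
      ∑ i, ((u i ⬝ᵥ x) * (v i ⬝ᵥ y) - (v i ⬝ᵥ x) * (u i ⬝ᵥ y)) := fun x y => by
    have hB : x ⬝ᵥ (Q + Qᵀ) *ᵥ y =
        ∑ i, ((u i ⬝ᵥ x) * (v i ⬝ᵥ y) - (v i ⬝ᵥ x) * (u i ⬝ᵥ y)) := by
      have hM : Q + Qᵀ = ∑ i, (vecMulVec (u i) (v i) - vecMulVec (v i) (u i)) := by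
        ext a b
        rw [huv, Matrix.sum_apply]
        rfl
      rw [hM, Matrix.sum_mulVec, dotProduct_sum]
      refine Finset.sum_congr rfl fun i _ => ?_
      simp [Matrix.sub_mulVec, Matrix.vecMulVec_mulVec, dotProduct_comm x, mul_comm]
    have hT : x ⬝ᵥ Qᵀ *ᵥ y = y ⬝ᵥ Q *ᵥ x := by
      rw [Matrix.mulVec_transpose, dotProduct_comm, ← Matrix.dotProduct_mulVec]
    have hd : ∀ s t : Fin n → ZMod 2, dotp s t = s ⬝ᵥ t := fun _ _ => rfl
    rw [← hB]
    simp only [hf, hd, Matrix.mulVec_add, Matrix.add_mulVec, dotProduct_add, add_dotProduct, hT]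
    ring
  let ℓ : (Fin n → ZMod 2) →+ ZMod 2 := AddMonoidHom.mk' (fun x => f (x ᵥ* (P⁻¹)ᵀ) -
      ∑ i : Fin h, x ⟨2 * i, by omega⟩ * x ⟨2 * i + 1, by omega⟩) fun x y => by
    simp only [Matrix.add_vecMul, hpolar, hu, hv, Pi.add_apply, CharTwo.sub_eq_add, add_mul,
      mul_add, Finset.sum_add_distrib]
    have hcomm : ∑ i : Fin h, x ⟨2 * i + 1, by omega⟩ * y ⟨2 * i, by omega⟩ =
      ∑ i : Fin h, y ⟨2 * i, by omega⟩ * x ⟨2 * i + 1, by omega⟩ :=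
        Finset.sum_congr rfl fun _ _ => mul_comm _ _
    rw [hcomm]
    grind
  refine ⟨(P⁻¹)ᵀ, ?_, fun k => ℓ (Pi.single k 1), fun x => ?_⟩
  · rw [Matrix.isUnit_transpose, Matrix.isUnit_nonsing_inv_iff]
    exact hP
  · have hx := LinearMap.pi_apply_eq_sum_univ (ℓ.toZModLinearMap 2) x
    rw [← sub_eq_iff_eq_add']
    refine hx.trans (Finset.sum_congr rfl fun k _ => ?_)
    rw [smul_eq_mul, mul_comm]
    refine congrArg (fun y => ℓ y * x k) (funext fun j => ?_)
    simp [Pi.single_apply, eq_comm]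
end
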